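/- Suppose h satisfies 0 < h ≤ 0.5869 and b > 0 satisfies h·exp(−h²/2) = (√3/2)·b·exp(−b²/2). Then b ≤ 0.7645 or b ≥ 1.2568. -/

import Mathlib

theorem hasDerivAt_mul_exp_neg_sq_half (t : ℝ) :
    HasDerivAt (fun x : ℝ => x * Real.exp (-x ^ 2 / 2))
      ((1 - t ^ 2) * Real.exp (-t ^ 2 / 2)) t := by
  have hexp : HasDerivAt (fun x : ℝ => -x ^ 2 / 2) (-t) t := by
    refine ((hasDerivAt_pow 2 t).fun_neg.div_const 2).congr_deriv ?_
    norm_num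
    ring
  refine ((hasDerivAt_id' t).fun_mul hexp.exp).congr_deriv ?_
  ring

theorem monotoneOn_mul_exp_neg_sq_half :
    MonotoneOn (fun x : ℝ => x * Real.exp (-x ^ 2 / 2)) (Set.Icc 0 1) := by
  refine monotoneOn_of_deriv_nonneg (convex_Icc 0 1) (by fun_prop)
    (fun t _ => (hasDerivAt_mul_exp_neg_sq_half t).differentiableAt.differentiableWithinAt) ?_
  intro t ht
  rw [interior_Icc] at ht
  rw [(hasDerivAt_mul_exp_neg_sq_half t).deriv]
  exact mul_nonneg (by nlinarith [ht.1, ht.2]) (Real.exp_pos _).le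

theorem antitoneOn_mul_exp_neg_sq_half :
    AntitoneOn (fun x : ℝ => x * Real.exp (-x ^ 2 / 2)) (Set.Ici 1) := by
  refine antitoneOn_of_deriv_nonpos (convex_Ici 1) (by fun_prop)
    (fun t _ => (hasDerivAt_mul_exp_neg_sq_half t).differentiableAt.differentiableWithinAt) ?_
  intro t ht
  rw [interior_Ici] at ht
  have ht' : 1 < t := ht
  rw [(hasDerivAt_mul_exp_neg_sq_half t).deriv]
  exact mul_nonpos_of_nonpos_of_nonneg (by nlinarith) (Real.exp_pos _).le

theorem mul_exp_neg_sq_half_le_of_le {h : ℝ} (h0 : 0 ≤ h) (hh : h ≤ 0.5869) :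
    h * Real.exp (-h ^ 2 / 2) ≤ 0.49405 := by
  refine (monotoneOn_mul_exp_neg_sq_half ⟨h0, by linarith⟩
    (by constructor <;> norm_num : (0.5869 : ℝ) ∈ Set.Icc 0 1) hh).trans ?_
  have hexp := Real.exp_bound (x := -0.5869 ^ 2 / 2)
    (by rw [abs_le]; constructor <;> norm_num) (n := 6) (by norm_num)
  rw [abs_le] at hexp
  norm_num [Finset.sum_range_succ, Nat.factorial] at hexp ⊢
  linarith [hexp.2]

theorem le_mul_exp_neg_sq_half {b : ℝ} (hb : 0.7645 ≤ b) (hb' : b ≤ 1.2568) :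
    0.57051 ≤ b * Real.exp (-b ^ 2 / 2) := by
  rcases le_total b 1 with hb1 | hb1
  · refine le_trans ?_ (monotoneOn_mul_exp_neg_sq_half
      (by constructor <;> norm_num : (0.7645 : ℝ) ∈ Set.Icc 0 1) ⟨by linarith, hb1⟩ hb)
    have hexp := Real.exp_bound (x := -0.7645 ^ 2 / 2)
      (by rw [abs_le]; constructor <;> norm_num) (n := 8) (by norm_num)
    rw [abs_le] at hexp
    norm_num [Finset.sum_range_succ, Nat.factorial] at hexp ⊢
    linarith [hexp.1]
  · refine le_trans ?_ (antitoneOn_mul_exp_neg_sq_half hb1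
      (by norm_num : (1.2568 : ℝ) ∈ Set.Ici 1) hb')
    have hexp := Real.exp_bound (x := -1.2568 ^ 2 / 2)
      (by rw [abs_le]; constructor <;> norm_num) (n := 10) (by norm_num)
    rw [abs_le] at hexp
    norm_num [Finset.sum_range_succ, Nat.factorial] at hexp ⊢
    linarith [hexp.1]

/-- If `0 < h ≤ 0.5869` and `b > 0` satisfy `h·e^{-h²/2} = (√3/2)·b·e^{-b²/2}`,
then `b ≤ 0.7645` or `b ≥ 1.2568`. -/
theorem b_dichotomy (h b : ℝ) (hh0 : 0 < h) (hh : h ≤ 0.5869) (hb : 0 < b)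
    (henergy : h * Real.exp (-h ^ 2 / 2)
      = Real.sqrt 3 / 2 * (b * Real.exp (-b ^ 2 / 2))) :
    b ≤ 0.7645 ∨ b ≥ 1.2568 := by
  by_contra! hcon
  have hleft := mul_exp_neg_sq_half_le_of_le hh0.le hh
  have hright := le_mul_exp_neg_sq_half hcon.1.le hcon.2.le
  have hsqrt : 1.732 ≤ Real.sqrt 3 := Real.le_sqrt_of_sq_le (by norm_num)
  nlinarith
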